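/- arXiv:2602.06853 — 6 statements merged into one kernel-verified Lean document; each statement's English description precedes it below -/
import Mathlib

section
/- Let (X,d,m) be a metric measure space and fix x0 ∈ X. Assume that for every λ > 0 the integral ∫_X exp(−2λ d(x0,x)²) dm(x) is finite, and that there exists a constant C > 0, independent of k, such that for every k ∈ ℕ and every Lipschitz function u : X → ℝ with bounded support, (∫_X d(x0,x)^{2k} (lip u(x))² dm)(∫_X d(x0,x)^{2k+2} u(x)² dm) ≥ (C+k)² (∫_X d(x0,x)^{2k} u(x)² dm)². Then for every ℓ ∈ ℕ the function ρ ↦ m^ℓ(B_ρ(x0))/ρ^{2(C+ℓ)} is non-decreasing on (0,∞), i.e. for all 0 < r ≤ R one has m^ℓ(B_r(x0))/r^{2(C+ℓ)} ≤ m^ℓ(B_R(x0))/R^{2(C+ℓ)}, where m^ℓ is the measure with density d(x0,·)^{2ℓ} with respect to m. -/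
open MeasureTheory Filter Metric
open scoped ENNReal Topology NNReal

/-- The local Lipschitz constant `lip u (x) = limsup_{y → x} |u y - u x| / d(y,x)`. -/
noncomputable def lip {X : Type*} [MetricSpace X] (u : X → ℝ) (x : X) : ℝ :=
  Filter.limsup (fun y => |u y - u x| / dist y x) (𝓝[≠] x)

/-- The probability that a Poisson variable of mean `x` is smaller than `n`. -/
noncomputable def poissonLT (n : ℕ) (x : ℝ) : ℝ :=
  Real.exp (-x) * ∑ j ∈ Finset.range n, x ^ j / j.factorial

/-- The `k`-th moment of `T` against the weight `exp (-s T)`. -/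
noncomputable def expMoment {X : Type*} [MeasurableSpace X] (μ : Measure X) (T : X → ℝ)
    (k : ℕ) (s : ℝ) : ℝ :=
  ∫ x, T x ^ k * Real.exp (-(s * T x)) ∂μ

lemma continuous_poissonLT (n : ℕ) : Continuous (poissonLT n) := by
  unfold poissonLT
  fun_prop

lemma poissonLT_nonneg (n : ℕ) {x : ℝ} (hx : 0 ≤ x) : 0 ≤ poissonLT n x := by
  unfold poissonLT
  positivity

lemma poissonLT_le_one (n : ℕ) {x : ℝ} (hx : 0 ≤ x) : poissonLT n x ≤ 1 := by
  unfold poissonLT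
  calc _ ≤ Real.exp (-x) * Real.exp x := by
        gcongr
        exact Real.sum_le_exp_of_nonneg hx n
    _ = 1 := by rw [← Real.exp_add]; simp

lemma hasSum_pow_div_factorial (x : ℝ) :
    HasSum (fun j : ℕ => x ^ j / j.factorial) (Real.exp x) := by
  rw [Real.exp_eq_exp_ℝ]
  exact NormedSpace.expSeries_div_hasSum_exp x

lemma poissonLT_chernoff {θ : ℝ} (hθ : 0 < θ) (hθ1 : θ ≤ 1) (n : ℕ) {x : ℝ} (hx : 0 ≤ x) :
    poissonLT n x ≤ θ⁻¹ ^ n * Real.exp (-((1 - θ) * x)) := by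
  have h : ∑ j ∈ Finset.range n, x ^ j / j.factorial ≤ θ⁻¹ ^ n * Real.exp (θ * x) := by
    calc _ ≤ ∑ j ∈ Finset.range n, θ⁻¹ ^ n * ((θ * x) ^ j / j.factorial) := by
          refine Finset.sum_le_sum fun j hj => ?_
          have h1 : 1 ≤ θ⁻¹ ^ n * θ ^ j := by
            rw [inv_pow, inv_mul_eq_div, one_le_div (by positivity)]
            exact pow_le_pow_of_le_one hθ.le hθ1 (Finset.mem_range.1 hj).le
          calc _ ≤ (θ⁻¹ ^ n * θ ^ j) * (x ^ j / j.factorial) :=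
                le_mul_of_one_le_left (by positivity) h1
            _ = _ := by rw [mul_pow]; ring
      _ ≤ _ := by
          rw [← Finset.mul_sum]
          gcongr
          exact Real.sum_le_exp_of_nonneg (by positivity) n
  unfold poissonLT
  calc _ ≤ Real.exp (-x) * (θ⁻¹ ^ n * Real.exp (θ * x)) := by gcongr
    _ = θ⁻¹ ^ n * (Real.exp (-x) * Real.exp (θ * x)) := by ring
    _ = _ := by rw [← Real.exp_add]; ring_nf

lemma one_sub_poissonLT_chernoff {θ : ℝ} (hθ1 : 1 ≤ θ) (n : ℕ) {x : ℝ} (hx : 0 ≤ x) :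
    1 - poissonLT n x ≤ θ⁻¹ ^ n * Real.exp ((θ - 1) * x) := by
  have hθ : 0 < θ := by linarith
  have h : Real.exp x ≤
      ∑ j ∈ Finset.range n, x ^ j / j.factorial + θ⁻¹ ^ n * Real.exp (θ * x) := by
    have hfin : HasSum (fun j : ℕ => if j < n then x ^ j / j.factorial else 0)
        (∑ j ∈ Finset.range n, x ^ j / j.factorial) := by
      have := hasSum_sum_of_ne_finset_zero (L := SummationFilter.unconditional ℕ)
        (f := fun j : ℕ => if j < n then x ^ j / (j.factorial : ℝ) else 0)
        (s := Finset.range n) (fun j hj => if_neg (by simpa using hj))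
      rwa [Finset.sum_congr rfl fun j hj => if_pos (Finset.mem_range.1 hj)] at this
    refine hasSum_le (fun j => ?_) (hasSum_pow_div_factorial x)
      (hfin.add ((hasSum_pow_div_factorial (θ * x)).mul_left (θ⁻¹ ^ n)))
    by_cases hj : j < n
    · simp only [hj, if_true]
      have : 0 ≤ θ⁻¹ ^ n * ((θ * x) ^ j / j.factorial) := by positivity
      linarith
    · simp only [hj, if_false, zero_add]
      have h1 : 1 ≤ θ⁻¹ ^ n * θ ^ j := by
        rw [inv_pow, inv_mul_eq_div, one_le_div (by positivity)]
        exact pow_le_pow_right₀ hθ1 (not_lt.1 hj)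
      calc _ ≤ (θ⁻¹ ^ n * θ ^ j) * (x ^ j / j.factorial) :=
            le_mul_of_one_le_left (by positivity) h1
        _ = _ := by rw [mul_pow]; ring
  have h2 : 1 ≤ Real.exp (-x) * (∑ j ∈ Finset.range n, x ^ j / j.factorial
      + θ⁻¹ ^ n * Real.exp (θ * x)) := by
    calc (1 : ℝ) = Real.exp (-x) * Real.exp x := by rw [← Real.exp_add]; simp
      _ ≤ _ := by gcongr
  have h3 : Real.exp (-x) * Real.exp (θ * x) = Real.exp ((θ - 1) * x) := by
    rw [← Real.exp_add]; ring_nf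
  unfold poissonLT
  rw [← h3]
  linarith

lemma mul_exp_one_sub_lt_one {y : ℝ} (hy : y ≠ 1) : y * Real.exp (1 - y) < 1 := by
  have h := Real.add_one_lt_exp (sub_ne_zero.2 hy)
  calc y * Real.exp (1 - y) < Real.exp (y - 1) * Real.exp (1 - y) := by
        gcongr
        linarith
    _ = 1 := by rw [← Real.exp_add]; simp

lemma tendsto_poissonLT_of_one_lt {y : ℝ} (hy : 1 < y) :
    Tendsto (fun n : ℕ => poissonLT (n + 1) ((n + 1 : ℕ) * y)) atTop (𝓝 0) := by
  have hy0 : 0 < y := by linarith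
  have h := (tendsto_add_atTop_iff_nat 1).2 <| tendsto_pow_atTop_nhds_zero_of_lt_one
    (r := y * Real.exp (1 - y)) (by positivity) (mul_exp_one_sub_lt_one hy.ne')
  refine squeeze_zero (fun n => poissonLT_nonneg _ (by positivity)) (fun n => ?_) h
  refine (poissonLT_chernoff (inv_pos.2 hy0) (inv_le_one_of_one_le₀ hy.le) _
    (by positivity)).trans_eq ?_
  rw [mul_pow, ← Real.exp_nat_mul, inv_inv]
  congr 2
  field_simp
  ring

lemma tendsto_poissonLT_of_lt_one {y : ℝ} (hy0 : 0 ≤ y) (hy : y < 1) :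
    Tendsto (fun n : ℕ => poissonLT (n + 1) ((n + 1 : ℕ) * y)) atTop (𝓝 1) := by
  suffices H : Tendsto (fun n : ℕ => 1 - poissonLT (n + 1) ((n + 1 : ℕ) * y)) atTop (𝓝 0) by
    simpa using H.const_sub 1
  obtain ⟨θ, hθ, hlt⟩ : ∃ θ : ℝ, 1 ≤ θ ∧ θ⁻¹ * Real.exp ((θ - 1) * y) < 1 := by
    rcases hy0.eq_or_lt with rfl | hy0
    · exact ⟨2, by norm_num, by norm_num⟩
    · refine ⟨y⁻¹, (one_le_inv₀ hy0).2 hy.le, ?_⟩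
      rw [inv_inv, sub_mul, inv_mul_cancel₀ hy0.ne', one_mul]
      exact mul_exp_one_sub_lt_one hy.ne
  have h := (tendsto_add_atTop_iff_nat 1).2 <| tendsto_pow_atTop_nhds_zero_of_lt_one
    (by positivity) hlt
  refine squeeze_zero (fun n => sub_nonneg.2 (poissonLT_le_one _ (by positivity)))
    (fun n => ?_) h
  refine (one_sub_poissonLT_chernoff hθ _ (by positivity)).trans_eq ?_
  rw [mul_pow, ← Real.exp_nat_mul]
  congr 2
  ring

lemma poissonLT_succ_le_exp (n : ℕ) {y : ℝ} (hy : 0 ≤ y) :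
    poissonLT (n + 1) ((n + 1 : ℕ) * y) ≤ 2 * Real.exp (-(y / 2)) := by
  by_cases h : 2 * Real.exp (-(y / 2)) ≤ 1
  · calc _ ≤ (2 * Real.exp (-(y / 2))) ^ (n + 1) := by
          refine (poissonLT_chernoff (θ := 1 / 2) (by norm_num) (by norm_num) _
            (by positivity)).trans_eq ?_
          rw [mul_pow, ← Real.exp_nat_mul]
          congr 2
          · norm_num
          · ring
      _ ≤ _ := pow_le_of_le_one (by positivity) h (by simp)
  · exact (poissonLT_le_one _ (by positivity)).trans (not_le.1 h).le

lemma norm_pow_mul_poissonLT_le {X : Type*} {T : X → ℝ} (hT0 : ∀ x, 0 ≤ T x) (ℓ n : ℕ)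
    {r : ℝ} (hr : 0 < r) (x : X) :
    ‖T x ^ ℓ * poissonLT (n + 1) ((n + 1 : ℕ) * (T x / r))‖ ≤
      2 * (T x ^ ℓ * Real.exp (-(1 / (2 * r) * T x))) := by
  have hx := hT0 x
  rw [Real.norm_of_nonneg (mul_nonneg (by positivity) (poissonLT_nonneg _ (by positivity)))]
  calc _ ≤ T x ^ ℓ * (2 * Real.exp (-(T x / r / 2))) := by
        gcongr
        exact poissonLT_succ_le_exp n (by positivity)
    _ = _ := by
        rw [show T x / r / 2 = 1 / (2 * r) * T x by field_simp]
        ring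

section ExpMoment

variable {X : Type*} [MeasurableSpace X] {μ : Measure X} {T : X → ℝ}

lemma integrable_pow_mul_exp (hT : Measurable T) (hT0 : ∀ x, 0 ≤ T x)
    (hint : ∀ s : ℝ, 0 < s → Integrable (fun x => Real.exp (-(s * T x))) μ) (k : ℕ)
    {s : ℝ} (hs : 0 < s) : Integrable (fun x => T x ^ k * Real.exp (-(s * T x))) μ := by
  refine ((hint (s / 2) (by positivity)).const_mul (k.factorial * (2 / s) ^ k)).mono'
    (by fun_prop) (ae_of_all _ fun x => ?_)
  have hx := hT0 x
  rw [Real.norm_of_nonneg (by positivity)]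
  have h := Real.pow_div_factorial_le_exp (s / 2 * T x) (by positivity) k
  rw [div_le_iff₀ (by positivity), mul_pow] at h
  calc T x ^ k * Real.exp (-(s * T x))
      = (2 / s) ^ k * ((s / 2) ^ k * T x ^ k) * Real.exp (-(s * T x)) := by
        rw [← mul_assoc, ← mul_pow]
        have : 2 / s * (s / 2) = 1 := by field_simp
        rw [this]; simp
    _ ≤ (2 / s) ^ k * (Real.exp (s / 2 * T x) * k.factorial) * Real.exp (-(s * T x)) := by
        gcongr
    _ = k.factorial * (2 / s) ^ k * (Real.exp (s / 2 * T x) * Real.exp (-(s * T x))) := by ring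
    _ = _ := by rw [← Real.exp_add]; ring_nf

lemma expMoment_nonneg (hT0 : ∀ x, 0 ≤ T x) (k : ℕ) (s : ℝ) : 0 ≤ expMoment μ T k s :=
  integral_nonneg fun x => mul_nonneg (pow_nonneg (hT0 x) k) (Real.exp_pos _).le

lemma hasDerivAt_expMoment (hT : Measurable T) (hT0 : ∀ x, 0 ≤ T x)
    (hint : ∀ s : ℝ, 0 < s → Integrable (fun x => Real.exp (-(s * T x))) μ) (k : ℕ)
    {s : ℝ} (hs : 0 < s) :
    HasDerivAt (expMoment μ T k) (-expMoment μ T (k + 1) s) s := by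
  have h := (hasDerivAt_integral_of_dominated_loc_of_deriv_le (μ := μ) (x₀ := s)
    (F := fun s x => T x ^ k * Real.exp (-(s * T x)))
    (F' := fun s x => -(T x ^ (k + 1) * Real.exp (-(s * T x))))
    (bound := fun x => T x ^ (k + 1) * Real.exp (-(s / 2 * T x)))
    (Ioi_mem_nhds (half_lt_self hs)) (Eventually.of_forall fun s => by fun_prop)
    (integrable_pow_mul_exp hT hT0 hint k hs) (by fun_prop)
    (ae_of_all _ fun x t ht => ?_) (integrable_pow_mul_exp hT hT0 hint (k + 1) (half_pos hs))
    (ae_of_all _ fun x t ht => ?_)).2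
  · rw [integral_neg] at h
    exact h
  · have hx := hT0 x
    rw [norm_neg, Real.norm_of_nonneg (by positivity)]
    have : s / 2 ≤ t := le_of_lt ht
    gcongr
  · refine ((((hasDerivAt_id t).mul_const (T x)).fun_neg.exp).const_mul (T x ^ k)).congr_deriv ?_
    simp only [id]
    ring

lemma hasDerivAt_sum_expMoment (hT : Measurable T) (hT0 : ∀ x, 0 ≤ T x)
    (hint : ∀ s : ℝ, 0 < s → Integrable (fun x => Real.exp (-(s * T x))) μ) (ℓ n : ℕ)
    {s : ℝ} (hs : 0 < s) :
    HasDerivAt (fun s => ∑ j ∈ Finset.range (n + 1),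
        s ^ j / j.factorial * expMoment μ T (j + ℓ) s)
      (-(s ^ n / n.factorial * expMoment μ T (n + 1 + ℓ) s)) s := by
  induction n with
  | zero =>
    simpa [add_comm] using hasDerivAt_expMoment hT hT0 hint ℓ hs
  | succ n ih =>
    simp only [Finset.sum_range_succ _ (n + 1)]
    have h := ih.add (((hasDerivAt_pow (n + 1) s).div_const ((n + 1).factorial : ℝ)).mul
      (hasDerivAt_expMoment hT hT0 hint (n + 1 + ℓ) hs))
    refine h.congr_deriv ?_
    have h1 : ((n + 1 : ℕ) : ℝ) * s ^ (n + 1 - 1) / (n + 1).factorial = s ^ n / n.factorial := by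
      rw [Nat.factorial_succ]
      push_cast
      field_simp
    rw [h1, show n + 1 + 1 + ℓ = n + 1 + ℓ + 1 by ring]
    ring

lemma sum_expMoment_le {C : ℝ}
    (hF : ∀ (k : ℕ) (s : ℝ), 0 < s → (C + k) * expMoment μ T k s ≤ s * expMoment μ T (k + 1) s)
    (ℓ n : ℕ) {s : ℝ} (hs : 0 < s) :
    (C + ℓ) * ∑ j ∈ Finset.range (n + 1), s ^ j / j.factorial * expMoment μ T (j + ℓ) s ≤
      s * (s ^ n / n.factorial * expMoment μ T (n + 1 + ℓ) s) := by
  induction n with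
  | zero => simpa [add_comm] using hF ℓ s hs
  | succ n ih =>
    rw [Finset.sum_range_succ, mul_add]
    have h := mul_le_mul_of_nonneg_left (hF (n + 1 + ℓ) s hs)
      (show 0 ≤ s ^ (n + 1) / (n + 1).factorial by positivity)
    have h1 : s * (s ^ n / n.factorial * expMoment μ T (n + 1 + ℓ) s) =
        s ^ (n + 1) / (n + 1).factorial * ((n + 1) * expMoment μ T (n + 1 + ℓ) s) := by
      rw [Nat.factorial_succ]
      push_cast
      field_simp
      ring
    rw [h1] at ih
    rw [show n + 1 + 1 + ℓ = n + 1 + ℓ + 1 by ring]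
    push_cast at h
    nlinarith [h, ih]

lemma antitoneOn_rpow_mul_sum_expMoment (hT : Measurable T) (hT0 : ∀ x, 0 ≤ T x)
    (hint : ∀ s : ℝ, 0 < s → Integrable (fun x => Real.exp (-(s * T x))) μ) {C : ℝ}
    (hF : ∀ (k : ℕ) (s : ℝ), 0 < s → (C + k) * expMoment μ T k s ≤ s * expMoment μ T (k + 1) s)
    (ℓ n : ℕ) :
    AntitoneOn (fun s => s ^ (C + ℓ) * ∑ j ∈ Finset.range (n + 1),
        s ^ j / j.factorial * expMoment μ T (j + ℓ) s) (Set.Ioi 0) := by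
  have hd : ∀ s ∈ Set.Ioi (0 : ℝ), HasDerivAt (fun s => s ^ (C + ℓ) *
      ∑ j ∈ Finset.range (n + 1), s ^ j / j.factorial * expMoment μ T (j + ℓ) s) _ s :=
    fun s hs => (Real.hasDerivAt_rpow_const (p := C + ℓ) (Or.inl (ne_of_gt hs))).mul
      (hasDerivAt_sum_expMoment hT hT0 hint ℓ n hs)
  refine antitoneOn_of_deriv_nonpos (convex_Ioi 0)
    (fun s hs => (hd s hs).continuousAt.continuousWithinAt) ?_ ?_
  · rw [interior_Ioi]
    exact fun s hs => (hd s hs).differentiableAt.differentiableWithinAt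
  · rw [interior_Ioi]
    intro s hs
    rw [(hd s hs).deriv]
    have hs0 : 0 < s := hs
    have h := mul_le_mul_of_nonneg_left (sum_expMoment_le hF ℓ n hs0)
      (show 0 ≤ s ^ (C + ℓ - 1) by positivity)
    have h1 : s ^ (C + ℓ) = s ^ (C + ℓ - 1) * s := by
      rw [← Real.rpow_add_one hs0.ne']; ring_nf
    rw [h1]
    linarith

lemma sum_expMoment_eq_integral (hT : Measurable T) (hT0 : ∀ x, 0 ≤ T x)
    (hint : ∀ s : ℝ, 0 < s → Integrable (fun x => Real.exp (-(s * T x))) μ) (ℓ n : ℕ)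
    {s : ℝ} (hs : 0 < s) :
    ∑ j ∈ Finset.range n, s ^ j / j.factorial * expMoment μ T (j + ℓ) s =
      ∫ x, T x ^ ℓ * poissonLT n (s * T x) ∂μ := by
  unfold expMoment poissonLT
  simp_rw [← integral_const_mul]
  rw [← integral_finsetSum _ fun j _ => (integrable_pow_mul_exp hT hT0 hint _ hs).const_mul _]
  congr 1 with x
  simp only [Finset.mul_sum]
  refine Finset.sum_congr rfl fun j _ => ?_
  rw [mul_pow]
  ring

lemma integral_poissonLT_div_rpow_le (hT : Measurable T) (hT0 : ∀ x, 0 ≤ T x)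
    (hint : ∀ s : ℝ, 0 < s → Integrable (fun x => Real.exp (-(s * T x))) μ) {C : ℝ}
    (hF : ∀ (k : ℕ) (s : ℝ), 0 < s → (C + k) * expMoment μ T k s ≤ s * expMoment μ T (k + 1) s)
    (ℓ n : ℕ) {r a : ℝ} (hr : 0 < r) (hra : r ≤ a) :
    (∫ x, T x ^ ℓ * poissonLT (n + 1) ((n + 1 : ℕ) * (T x / r)) ∂μ) / r ^ (C + ℓ) ≤
      (∫ x, T x ^ ℓ * poissonLT (n + 1) ((n + 1 : ℕ) * (T x / a)) ∂μ) / a ^ (C + ℓ) := by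
  have ha : 0 < a := hr.trans_le hra
  have hn : (0 : ℝ) < (n + 1 : ℕ) := by positivity
  have h := antitoneOn_rpow_mul_sum_expMoment hT hT0 hint hF ℓ n
    (a := (n + 1 : ℕ) / a) (b := (n + 1 : ℕ) / r) (div_pos hn ha) (div_pos hn hr)
    (by gcongr)
  simp only [sum_expMoment_eq_integral hT hT0 hint ℓ _ (div_pos hn ha),
    sum_expMoment_eq_integral hT hT0 hint ℓ _ (div_pos hn hr),
    Real.div_rpow hn.le ha.le, Real.div_rpow hn.le hr.le] at h
  simp only [div_mul_eq_mul_div, mul_div_assoc] at h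
  have hnp : (0 : ℝ) < ((n + 1 : ℕ) : ℝ) ^ (C + ℓ) := by positivity
  rwa [mul_le_mul_iff_right₀ hnp] at h

lemma measurable_pow_mul_poissonLT (hT : Measurable T) (ℓ n : ℕ) (c r : ℝ) :
    Measurable fun x => T x ^ ℓ * poissonLT n (c * (T x / r)) :=
  (hT.pow_const ℓ).mul ((continuous_poissonLT n).measurable.comp
    ((hT.div_const r).const_mul c))

lemma integrable_pow_mul_poissonLT (hT : Measurable T) (hT0 : ∀ x, 0 ≤ T x)
    (hint : ∀ s : ℝ, 0 < s → Integrable (fun x => Real.exp (-(s * T x))) μ) (ℓ n : ℕ)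
    {r : ℝ} (hr : 0 < r) :
    Integrable (fun x => T x ^ ℓ * poissonLT (n + 1) ((n + 1 : ℕ) * (T x / r))) μ :=
  ((integrable_pow_mul_exp hT hT0 hint ℓ (by positivity)).const_mul 2).mono'
    (measurable_pow_mul_poissonLT hT ℓ _ _ r).aestronglyMeasurable
    (ae_of_all _ (norm_pow_mul_poissonLT_le hT0 ℓ n hr))

lemma integrableOn_pow_of_le (hT : Measurable T) (hT0 : ∀ x, 0 ≤ T x)
    (hint : ∀ s : ℝ, 0 < s → Integrable (fun x => Real.exp (-(s * T x))) μ) (ℓ : ℕ) (r : ℝ) :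
    IntegrableOn (fun x => T x ^ ℓ) {x | T x ≤ r} μ := by
  refine ((integrable_pow_mul_exp hT hT0 hint ℓ one_pos).const_mul
    (Real.exp r)).integrableOn.mono' (by fun_prop) ?_
  filter_upwards [ae_restrict_mem (measurableSet_le hT measurable_const)] with x hx
  have hx0 := hT0 x
  have hxr : T x ≤ r := hx
  rw [Real.norm_of_nonneg (by positivity), mul_left_comm, ← Real.exp_add]
  exact le_mul_of_one_le_right (by positivity) (Real.one_le_exp (by linarith))

lemma tendsto_setIntegral_poissonLT (hT : Measurable T) (hT0 : ∀ x, 0 ≤ T x)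
    (hint : ∀ s : ℝ, 0 < s → Integrable (fun x => Real.exp (-(s * T x))) μ) (ℓ : ℕ)
    {r : ℝ} (hr : 0 < r) :
    Tendsto (fun n : ℕ => ∫ x in {x | T x < r},
        T x ^ ℓ * poissonLT (n + 1) ((n + 1 : ℕ) * (T x / r)) ∂μ) atTop
      (𝓝 (∫ x in {x | T x < r}, T x ^ ℓ ∂μ)) := by
  refine tendsto_integral_of_dominated_convergence
    (fun x => 2 * (T x ^ ℓ * Real.exp (-(1 / (2 * r) * T x))))
    (fun n => (measurable_pow_mul_poissonLT hT ℓ _ _ r).aestronglyMeasurable)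
    ((integrable_pow_mul_exp hT hT0 hint ℓ (by positivity)).const_mul 2).integrableOn
    (fun n => ae_of_all _ (norm_pow_mul_poissonLT_le hT0 ℓ n hr)) ?_
  filter_upwards [ae_restrict_mem (measurableSet_lt hT measurable_const)] with x hx
  simpa using (tendsto_poissonLT_of_lt_one (div_nonneg (hT0 x) hr.le)
    ((div_lt_one hr).2 hx)).const_mul (T x ^ ℓ)

lemma tendsto_setIntegral_poissonLT_of_lt (hT : Measurable T) (hT0 : ∀ x, 0 ≤ T x)
    (hint : ∀ s : ℝ, 0 < s → Integrable (fun x => Real.exp (-(s * T x))) μ) (ℓ : ℕ)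
    {r : ℝ} (hr : 0 < r) :
    Tendsto (fun n : ℕ => ∫ x in {x | T x ≤ r}ᶜ,
        T x ^ ℓ * poissonLT (n + 1) ((n + 1 : ℕ) * (T x / r)) ∂μ) atTop (𝓝 0) := by
  have h : Tendsto (fun n : ℕ => ∫ x in {x | T x ≤ r}ᶜ,
      T x ^ ℓ * poissonLT (n + 1) ((n + 1 : ℕ) * (T x / r)) ∂μ) atTop
      (𝓝 (∫ x in {x | T x ≤ r}ᶜ, (0 : ℝ) ∂μ)) := by
    refine tendsto_integral_of_dominated_convergence
      (fun x => 2 * (T x ^ ℓ * Real.exp (-(1 / (2 * r) * T x))))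
      (fun n => (measurable_pow_mul_poissonLT hT ℓ _ _ r).aestronglyMeasurable)
      ((integrable_pow_mul_exp hT hT0 hint ℓ (by positivity)).const_mul 2).integrableOn
      (fun n => ae_of_all _ (norm_pow_mul_poissonLT_le hT0 ℓ n hr)) ?_
    filter_upwards [ae_restrict_mem (measurableSet_le hT measurable_const).compl] with x hx
    have hx : r < T x := not_le.1 hx
    simpa using (tendsto_poissonLT_of_one_lt ((one_lt_div hr).2 hx)).const_mul (T x ^ ℓ)
  simpa using h

/-- If the exponential moments of `T` satisfy `(C + k) F k ≤ s F (k + 1)`, then the growth of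
the sublevel sets of `T`, weighted by `T ^ ℓ`, is at least of order `C + ℓ`. -/
lemma setIntegral_pow_div_rpow_le (hT : Measurable T) (hT0 : ∀ x, 0 ≤ T x)
    (hint : ∀ s : ℝ, 0 < s → Integrable (fun x => Real.exp (-(s * T x))) μ) {C : ℝ}
    (hF : ∀ (k : ℕ) (s : ℝ), 0 < s → (C + k) * expMoment μ T k s ≤ s * expMoment μ T (k + 1) s)
    (ℓ : ℕ) {r R : ℝ} (hr : 0 < r) (hrR : r < R) :
    (∫ x in {x | T x < r}, T x ^ ℓ ∂μ) / r ^ (C + ℓ) ≤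
      (∫ x in {x | T x < R}, T x ^ ℓ ∂μ) / R ^ (C + ℓ) := by
  have hcl : ∀ a : ℝ, r ≤ a → (∫ x in {x | T x < r}, T x ^ ℓ ∂μ) / r ^ (C + ℓ) ≤
      (∫ x in {x | T x ≤ a}, T x ^ ℓ ∂μ) / a ^ (C + ℓ) := by
    intro a hra
    have ha : 0 < a := hr.trans_le hra
    have hlim := ((tendsto_setIntegral_poissonLT_of_lt hT hT0 hint ℓ ha).const_add
      (∫ x in {x | T x ≤ a}, T x ^ ℓ ∂μ)).div_const (a ^ (C + ℓ))
    rw [add_zero] at hlim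
    refine le_of_tendsto_of_tendsto'
      ((tendsto_setIntegral_poissonLT hT hT0 hint ℓ hr).div_const (r ^ (C + ℓ))) hlim
      fun n => ?_
    refine le_trans ?_ ((integral_poissonLT_div_rpow_le hT hT0 hint hF ℓ n hr hra).trans ?_)
    · gcongr ?_ / _
      exact setIntegral_le_integral (integrable_pow_mul_poissonLT hT hT0 hint ℓ n hr)
        (ae_of_all _ fun x => mul_nonneg (pow_nonneg (hT0 x) ℓ)
          (poissonLT_nonneg _ (by have := hT0 x; positivity)))
    · gcongr ?_ / _
      have hI := integrable_pow_mul_poissonLT hT hT0 hint ℓ n ha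
      rw [← integral_add_compl (measurableSet_le hT (measurable_const (a := a))) hI]
      gcongr ?_ + _
      refine integral_mono hI.integrableOn (integrableOn_pow_of_le hT hT0 hint ℓ a) fun x => ?_
      have hx := hT0 x
      exact mul_le_of_le_one_right (by positivity) (poissonLT_le_one _ (by positivity))
  have hR : 0 < R := hr.trans hrR
  have hlim : Tendsto (fun a : ℝ => (∫ x in {x | T x < R}, T x ^ ℓ ∂μ) / a ^ (C + ℓ))
      (𝓝[<] R) (𝓝 ((∫ x in {x | T x < R}, T x ^ ℓ ∂μ) / R ^ (C + ℓ))) := by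
    refine tendsto_nhdsWithin_of_tendsto_nhds (Tendsto.div tendsto_const_nhds ?_ (by positivity))
    exact (Real.continuousAt_rpow_const R _ (Or.inl hR.ne')).tendsto
  refine ge_of_tendsto hlim ?_
  filter_upwards [Ioo_mem_nhdsLT hrR] with a ha
  refine (hcl a ha.1.le).trans ?_
  have ha0 : 0 < a := hr.trans ha.1
  gcongr ?_ / _
  refine setIntegral_mono_set ?_ (ae_of_all _ fun x => pow_nonneg (hT0 x) ℓ)
    (LE.le.eventuallyLE fun x hx => lt_of_le_of_lt hx ha.2)
  exact (integrableOn_pow_of_le hT hT0 hint ℓ R).mono_set fun x hx => le_of_lt (a := T x) (b := R) hx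

end ExpMoment

section Lip

variable {X : Type*} [MetricSpace X]

lemma lip_nonneg (u : X → ℝ) (x : X) : 0 ≤ lip u x := by
  unfold lip
  rcases (𝓝[≠] x).eq_or_neBot with h | h
  · simp [h, Filter.limsup_eq]
  · rw [Filter.limsup_eq]
    refine Real.sInf_nonneg fun a ha => ?_
    obtain ⟨y, hy⟩ := Eventually.exists (show ∀ᶠ y in 𝓝[≠] x, |u y - u x| / dist y x ≤ a from ha)
    exact le_trans (by positivity) hy

lemma lip_le_of_hasDerivAt {u D : X → ℝ} {g : ℝ → ℝ} {g' : ℝ} {x : X}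
    (hD : LipschitzWith 1 D) (hu : ∀ y, |u y - u x| ≤ |g (D y) - g (D x)|)
    (hg : HasDerivAt g g' (D x)) : lip u x ≤ |g'| := by
  unfold lip
  rcases (𝓝[≠] x).eq_or_neBot with h | h
  · simp [h, Filter.limsup_eq]
  refine le_of_forall_pos_le_add fun ε hε => ?_
  refine limsup_le_of_le ?_ ?_
  · exact IsBoundedUnder.isCoboundedUnder_le
      (isBoundedUnder_of_eventually_ge (a := 0) (Eventually.of_forall fun y => by positivity))
  · have h1 := hD.continuous.continuousAt.eventually ((hasDerivAt_iff_isLittleO.1 hg).def hε)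
    filter_upwards [h1.filter_mono nhdsWithin_le_nhds, self_mem_nhdsWithin] with y hy hne
    have hpos : 0 < dist y x := dist_pos.2 hne
    rw [div_le_iff₀ hpos]
    have hd : |D y - D x| ≤ dist y x := by simpa [Real.dist_eq] using hD.dist_le_mul y x
    simp only [Real.norm_eq_abs, smul_eq_mul] at hy
    calc |u y - u x| ≤ |g (D y) - g (D x)| := hu y
      _ = |(g (D y) - g (D x) - (D y - D x) * g') + (D y - D x) * g'| := by ring_nf
      _ ≤ ε * |D y - D x| + |D y - D x| * |g'| := by
          rw [← abs_mul]
          exact (abs_add_le _ _).trans (by gcongr)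
      _ = (|g'| + ε) * |D y - D x| := by ring
      _ ≤ (|g'| + ε) * dist y x := by gcongr

end Lip

lemma hasDerivAt_exp_neg_mul_sq (c t : ℝ) :
    HasDerivAt (fun t : ℝ => Real.exp (-(c * t ^ 2)))
      (-(2 * c * t * Real.exp (-(c * t ^ 2)))) t := by
  refine ((hasDerivAt_pow 2 t).const_mul c).fun_neg.exp.congr_deriv ?_
  push_cast
  ring

lemma exists_lipschitzWith_exp_neg_mul_sq {c : ℝ} (hc : 0 < c) :
    ∃ K : ℝ≥0, LipschitzWith K fun t : ℝ => Real.exp (-(c * t ^ 2)) := by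
  refine ⟨(c + 1).toNNReal, lipschitzWith_of_nnnorm_deriv_le
    (fun t => (hasDerivAt_exp_neg_mul_sq c t).differentiableAt) fun t => ?_⟩
  rw [(hasDerivAt_exp_neg_mul_sq c t).deriv, ← NNReal.coe_le_coe, coe_nnnorm,
    Real.coe_toNNReal _ (by positivity), norm_neg, norm_mul, Real.norm_eq_abs,
    Real.norm_of_nonneg (Real.exp_pos _).le, Real.exp_neg, ← div_eq_mul_inv,
    div_le_iff₀ (Real.exp_pos _)]
  have h1 : |2 * c * t| ≤ c * (1 + t ^ 2) := by
    rw [abs_le]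
    constructor <;> nlinarith [sq_nonneg (t + 1), sq_nonneg (t - 1)]
  have h2 := Real.add_one_le_exp (c * t ^ 2)
  have h3 : 0 ≤ c * t ^ 2 := by positivity
  nlinarith

lemma isBounded_support_max_exp_sub {X : Type*} [MetricSpace X] {x0 : X}
    {c ε : ℝ} (hc : 0 < c) (hε : 0 < ε) :
    Bornology.IsBounded
      (Function.support fun x : X => max (Real.exp (-(c * dist x0 x ^ 2)) - ε) 0) := by
  refine (isBounded_closedBall (x := x0) (r := 1 / (c * ε) + 1)).subset fun x hx => ?_
  rw [mem_closedBall, dist_comm]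
  by_contra! hlt
  refine hx (max_eq_right (sub_nonpos.2 ?_))
  have hd : 1 / (c * ε) ≤ dist x0 x ^ 2 := by
    have : 0 < 1 / (c * ε) := by positivity
    nlinarith
  have h1 : 1 / ε ≤ Real.exp (c * dist x0 x ^ 2) := by
    calc 1 / ε = c * (1 / (c * ε)) := by field_simp
      _ ≤ c * dist x0 x ^ 2 := by gcongr
      _ ≤ _ := by linarith [Real.add_one_le_exp (c * dist x0 x ^ 2)]
  rw [Real.exp_neg]
  exact inv_le_of_inv_le₀ hε (by simpa using h1)

section CaffarelliKohnNirenberg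

variable {X : Type*} [MetricSpace X] [MeasurableSpace X] [BorelSpace X] {m : Measure X} {x0 : X}
  {C : ℝ}

/-- The Caffarelli–Kohn–Nirenberg inequality tested on Gaussians centred at `x0`. -/
lemma expMoment_le_of_ckn
    (hint : ∀ s : ℝ, 0 < s → Integrable (fun x => Real.exp (-(s * dist x0 x ^ 2))) m)
    (hCKN : ∀ (k : ℕ) (u : X → ℝ), (∃ K : ℝ≥0, LipschitzWith K u) →
      Bornology.IsBounded (Function.support u) →
      (∫ x, dist x0 x ^ (2 * k) * (lip u x) ^ 2 ∂m) *
        (∫ x, dist x0 x ^ (2 * k + 2) * (u x) ^ 2 ∂m) ≥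
      (C + k) ^ 2 * (∫ x, dist x0 x ^ (2 * k) * (u x) ^ 2 ∂m) ^ 2)
    (k : ℕ) {s : ℝ} (hs : 0 < s) :
    (C + k) * expMoment m (fun x => dist x0 x ^ 2) k s ≤
      s * expMoment m (fun x => dist x0 x ^ 2) (k + 1) s := by
  set T : X → ℝ := fun x => dist x0 x ^ 2 with hTdef
  have hD : LipschitzWith 1 fun x : X => dist x0 x := LipschitzWith.dist_right x0
  have hT : Measurable T := (hD.continuous.measurable).pow_const 2
  have hT0 : ∀ x, 0 ≤ T x := fun x => by positivity
  have hI := fun k => integrable_pow_mul_exp hT hT0 hint k hs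
  have hk1 := expMoment_nonneg (μ := m) hT0 (k + 1) s
  set g : ℝ → ℝ := fun t => Real.exp (-(s / 2 * t ^ 2)) with hg
  have hgsq : ∀ x, g (dist x0 x) ^ 2 = Real.exp (-(s * T x)) := fun x => by
    rw [hg, ← Real.exp_nat_mul]
    congr 1
    simp only [hTdef]
    push_cast
    ring
  set u : ℝ → X → ℝ := fun ε x => max (g (dist x0 x) - ε) 0 with hu
  have hu0 : ∀ ε x, 0 ≤ u ε x := fun ε x => le_max_right _ _
  have hule : ∀ ε, 0 < ε → ∀ x, u ε x ^ 2 ≤ Real.exp (-(s * T x)) := fun ε hε x => by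
    rw [← hgsq]
    have : 0 ≤ g (dist x0 x) := (Real.exp_pos _).le
    exact pow_le_pow_left₀ (hu0 ε x) (max_le (by linarith) this) 2
  have hmain : ∀ ε, 0 < ε → (C + k) * ∫ x, T x ^ k * u ε x ^ 2 ∂m ≤
      s * expMoment m T (k + 1) s := by
    intro ε hε
    have hLip : ∃ K : ℝ≥0, LipschitzWith K (u ε) := by
      obtain ⟨K, hK⟩ := exists_lipschitzWith_exp_neg_mul_sq (half_pos hs)
      exact ⟨_, ((hK.comp hD).sub (LipschitzWith.const ε)).max_const 0⟩
    have h := hCKN k (u ε) hLip (isBounded_support_max_exp_sub (half_pos hs) hε)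
    have hlip : ∀ x, lip (u ε) x ^ 2 ≤ s ^ 2 * (T x * Real.exp (-(s * T x))) := fun x => by
      have h1 : lip (u ε) x ≤ _ := lip_le_of_hasDerivAt (g := g) hD
        (fun y => (abs_max_sub_max_le_abs _ _ _).trans_eq (by ring_nf))
        (hasDerivAt_exp_neg_mul_sq (s / 2) _)
      refine (pow_le_pow_left₀ (lip_nonneg _ _) h1 2).trans_eq ?_
      rw [sq_abs, neg_sq, mul_pow, show Real.exp (-(s / 2 * dist x0 x ^ 2)) ^ 2 =
        Real.exp (-(s * T x)) from hgsq x]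
      simp only [hTdef]
      ring
    have hpow : ∀ x, dist x0 x ^ (2 * k) = T x ^ k := fun x => pow_mul _ _ _
    have hpow' : ∀ x, dist x0 x ^ (2 * k + 2) = T x ^ (k + 1) := fun x => by
      rw [show 2 * k + 2 = 2 * (k + 1) by ring, pow_mul]
    simp only [hpow, hpow'] at h
    have hA : ∫ x, T x ^ k * lip (u ε) x ^ 2 ∂m ≤ s ^ 2 * expMoment m T (k + 1) s := by
      rw [expMoment, ← integral_const_mul]
      refine integral_mono_of_nonneg (ae_of_all _ fun x => by have := hT0 x; positivity)
        ((hI (k + 1)).const_mul _) (ae_of_all _ fun x => ?_)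
      calc _ ≤ T x ^ k * (s ^ 2 * (T x * Real.exp (-(s * T x)))) :=
            mul_le_mul_of_nonneg_left (hlip x) (pow_nonneg (hT0 x) k)
        _ = _ := by ring
    have hB : ∫ x, T x ^ (k + 1) * u ε x ^ 2 ∂m ≤ expMoment m T (k + 1) s :=
      integral_mono_of_nonneg (ae_of_all _ fun x => by have := hT0 x; positivity)
        (hI (k + 1)) (ae_of_all _ fun x =>
          mul_le_mul_of_nonneg_left (hule ε hε x) (pow_nonneg (hT0 x) _))
    have hB0 : 0 ≤ ∫ x, T x ^ (k + 1) * u ε x ^ 2 ∂m :=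
      integral_nonneg fun x => by have := hT0 x; positivity
    refine le_of_sq_le_sq ?_ (by positivity)
    calc _ = (C + k) ^ 2 * (∫ x, T x ^ k * u ε x ^ 2 ∂m) ^ 2 := by ring
      _ ≤ _ := h
      _ ≤ (s ^ 2 * expMoment m T (k + 1) s) * expMoment m T (k + 1) s :=
          mul_le_mul hA hB hB0 (by positivity)
      _ = _ := by ring
  have hlim : Tendsto (fun ε => ∫ x, T x ^ k * u ε x ^ 2 ∂m) (𝓝[>] 0)
      (𝓝 (expMoment m T k s)) := by
    refine tendsto_integral_filter_of_dominated_convergence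
      (fun x => T x ^ k * Real.exp (-(s * T x))) (Eventually.of_forall fun ε => ?_) ?_ (hI k)
      (ae_of_all _ fun x => ?_)
    · have : Measurable (u ε) := by
        have := hD.continuous.measurable
        simp only [hu, hg]
        fun_prop
      exact ((hT.pow_const k).mul (this.pow_const 2)).aestronglyMeasurable
    · filter_upwards [self_mem_nhdsWithin] with ε hε
      refine ae_of_all _ fun x => ?_
      rw [Real.norm_of_nonneg (by have := hT0 x; positivity)]
      exact mul_le_mul_of_nonneg_left (hule ε hε x) (pow_nonneg (hT0 x) _)
    · have hc : Continuous fun ε => T x ^ k * u ε x ^ 2 := by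
        simp only [hu]
        fun_prop
      have h0 : T x ^ k * u 0 x ^ 2 = T x ^ k * Real.exp (-(s * T x)) := by
        rw [← hgsq]
        simp only [hu, sub_zero]
        rw [max_eq_left (Real.exp_pos _).le]
      rw [← h0]
      exact tendsto_nhdsWithin_of_tendsto_nhds (hc.tendsto 0)
  exact le_of_tendsto (hlim.const_mul (C + k)) (by
    filter_upwards [self_mem_nhdsWithin] with ε hε using hmain ε hε)

end CaffarelliKohnNirenberg

theorem stmt_0 {X : Type*} [MetricSpace X] [CompleteSpace X]
    [TopologicalSpace.SeparableSpace X] [MeasurableSpace X] [BorelSpace X]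
    (m : Measure X)
    (hm : ∀ U : Set X, IsOpen U → U.Nonempty → Bornology.IsBounded U → 0 < m U ∧ m U < ⊤)
    (x0 : X)
    (hint : ∀ lam : ℝ, 0 < lam →
      (∫⁻ x, ENNReal.ofReal (Real.exp (-2 * lam * dist x0 x ^ 2)) ∂m) < ⊤)
    (C : ℝ) (hC : 0 < C)
    (hCKN : ∀ (k : ℕ) (u : X → ℝ), (∃ K : ℝ≥0, LipschitzWith K u) →
      Bornology.IsBounded (Function.support u) →
      (∫ x, dist x0 x ^ (2 * k) * (lip u x) ^ 2 ∂m) *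
        (∫ x, dist x0 x ^ (2 * k + 2) * (u x) ^ 2 ∂m) ≥
      (C + k) ^ 2 * (∫ x, dist x0 x ^ (2 * k) * (u x) ^ 2 ∂m) ^ 2)
    (ℓ : ℕ) :
    ∀ r R : ℝ, 0 < r → r ≤ R →
      (m.withDensity fun x => ENNReal.ofReal (dist x0 x ^ (2 * ℓ))) (ball x0 r) /
        ENNReal.ofReal (r ^ (2 * (C + ℓ))) ≤
      (m.withDensity fun x => ENNReal.ofReal (dist x0 x ^ (2 * ℓ))) (ball x0 R) /
        ENNReal.ofReal (R ^ (2 * (C + ℓ))) := by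
  intro r R hr hrR
  rcases hrR.eq_or_lt with rfl | hlt
  · exact le_rfl
  have hR : 0 < R := hr.trans hlt
  set T : X → ℝ := fun x => dist x0 x ^ 2 with hTdef
  have hT : Measurable T := by fun_prop
  have hT0 : ∀ x, 0 ≤ T x := fun x => by positivity
  have hint' : ∀ s : ℝ, 0 < s → Integrable (fun x => Real.exp (-(s * T x))) m := by
    intro s hs
    refine ⟨by fun_prop, ?_⟩
    rw [hasFiniteIntegral_iff_ofReal (ae_of_all _ fun x => (Real.exp_pos _).le)]
    convert hint (s / 2) (half_pos hs) using 5
    simp only [hTdef]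
    ring
  have key := setIntegral_pow_div_rpow_le hT hT0 hint'
    (fun k s hs => expMoment_le_of_ckn hint' hCKN k hs) ℓ
    (show 0 < r ^ 2 by positivity) (show r ^ 2 < R ^ 2 by gcongr)
  have hball : ∀ ρ : ℝ, 0 < ρ →
      (m.withDensity fun x => ENNReal.ofReal (dist x0 x ^ (2 * ℓ))) (ball x0 ρ) /
        ENNReal.ofReal (ρ ^ (2 * (C + ℓ))) =
      ENNReal.ofReal ((∫ x in {x | T x < ρ ^ 2}, T x ^ ℓ ∂m) / (ρ ^ 2) ^ (C + ℓ)) := by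
    intro ρ hρ
    have hset : {x | T x < ρ ^ 2} = ball x0 ρ := by
      ext x
      rw [Set.mem_ofPred_eq, mem_ball, dist_comm]
      exact sq_lt_sq₀ dist_nonneg hρ.le
    have hI : IntegrableOn (fun x => T x ^ ℓ) (ball x0 ρ) m := by
      rw [← hset]
      exact (integrableOn_pow_of_le hT hT0 hint' ℓ (ρ ^ 2)).mono_set fun x hx =>
        le_of_lt (a := T x) (b := ρ ^ 2) hx
    rw [hset, withDensity_apply _ measurableSet_ball, ENNReal.ofReal_div_of_pos (by positivity),
      ofReal_integral_eq_lintegral_ofReal hI (ae_of_all _ fun x => pow_nonneg (hT0 x) ℓ),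
      Real.rpow_mul hρ.le, Real.rpow_two]
    simp only [hTdef, pow_mul]
  rw [hball r hr, hball R hR]
  exact ENNReal.ofReal_le_ofReal key
end

section
/- Let N ∈ (1,∞) be a real number and k ∈ ℕ. Then for every Lipschitz function u : ℝ → ℝ with bounded support, (∫_0^∞ x^{N+2k−1} (u'(x))² dx) · (∫_0^∞ x^{N+2k+1} u(x)² dx) ≥ (N/2 + k)² · (∫_0^∞ x^{N+2k−1} u(x)² dx)², where u' denotes the (almost everywhere defined) derivative of u. -/
open MeasureTheory
open scoped ENNReal NNReal

/-- Integration by parts for `x ^ m * u x ^ 2` on `[0, R]`, where `u` vanishes at `R`. -/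
lemma LipschitzWith.mul_integral_rpow_mul_sq {u : ℝ → ℝ} {K : ℝ≥0} (hu : LipschitzWith K u)
    {m R : ℝ} (hm : 1 < m) (hR : u R = 0) :
    m * ∫ x in (0 : ℝ)..R, x ^ (m - 1) * u x ^ 2 =
      -2 * ∫ x in (0 : ℝ)..R, x ^ m * (u x * deriv u x) := by
  have hpow : ContDiff ℝ 1 fun x : ℝ ↦ x ^ m :=
    Real.contDiff_rpow_const_of_le (by simpa using hm.le)
  have hac_pow : AbsolutelyContinuousOnInterval (fun x : ℝ ↦ x ^ m) 0 R :=
    hpow.contDiffOn.absolutelyContinuousOnInterval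
  have hac_u : AbsolutelyContinuousOnInterval u 0 R :=
    hu.lipschitzOnWith.absolutelyContinuousOnInterval
  have key := hac_pow.integral_mul_deriv_eq_deriv_mul (hac_u.mul hac_u)
  have h₁ : ∫ x in (0 : ℝ)..R, x ^ m * deriv (u * u) x =
      ∫ x in (0 : ℝ)..R, 2 * (x ^ m * (u x * deriv u x)) := by
    refine intervalIntegral.integral_congr_ae ?_
    filter_upwards [hu.ae_differentiableAt_real] with x hx _
    rw [deriv_mul hx hx]
    ring
  have h₂ : ∫ x in (0 : ℝ)..R, deriv (fun x : ℝ ↦ x ^ m) x * (u * u) x =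
      ∫ x in (0 : ℝ)..R, m * (x ^ (m - 1) * u x ^ 2) := by
    refine intervalIntegral.integral_congr fun x _ ↦ ?_
    simp only [Real.deriv_rpow_const, Pi.mul_apply]
    ring
  rw [h₁, h₂, intervalIntegral.integral_const_mul, intervalIntegral.integral_const_mul] at key
  simp only [Pi.mul_apply, hR, Real.zero_rpow (by linarith : m ≠ 0)] at key
  linarith

/-- Cauchy–Schwarz for `x * u x` and `u' x` with respect to the weight `x ^ (m - 1)`. -/
lemma LipschitzWith.sq_integral_rpow_mul_deriv_le {u : ℝ → ℝ} {K : ℝ≥0} (hu : LipschitzWith K u)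
    {m R : ℝ} (hm : 1 < m) (hR : 0 ≤ R) :
    (∫ x in (0 : ℝ)..R, x ^ m * (u x * deriv u x)) ^ 2 ≤
      (∫ x in (0 : ℝ)..R, x ^ (m - 1) * deriv u x ^ 2) *
        ∫ x in (0 : ℝ)..R, x ^ (m + 1) * u x ^ 2 := by
  have hd : ∀ x, ‖deriv u x‖ ≤ K := fun x ↦ norm_deriv_le_of_lipschitz hu
  have hd_meas : Measurable (deriv u) := measurable_deriv u
  have hp : ∀ p : ℝ, 0 ≤ p → Continuous fun x : ℝ ↦ x ^ p := fun p h ↦ Real.continuous_rpow_const h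
  have hdi : IntervalIntegrable (deriv u) volume 0 R :=
    hu.lipschitzOnWith.absolutelyContinuousOnInterval.intervalIntegrable_deriv
  have hdi2 : IntervalIntegrable (fun x ↦ deriv u x ^ 2) volume 0 R := by
    rw [intervalIntegrable_iff] at hdi ⊢
    refine (hdi.mul_bdd (c := K) hd_meas.aestronglyMeasurable (.of_forall hd)).congr
      (.of_forall fun x ↦ ?_)
    simp [pow_two]
  have hA : IntervalIntegrable (fun x ↦ x ^ (m - 1) * deriv u x ^ 2) volume 0 R :=
    hdi2.continuousOn_mul (hp _ (by linarith)).continuousOn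
  have hB : IntervalIntegrable (fun x ↦ x ^ m * (u x * deriv u x)) volume 0 R :=
    (hdi.continuousOn_mul hu.continuous.continuousOn).continuousOn_mul
      (hp _ (by linarith)).continuousOn
  have hC : IntervalIntegrable (fun x ↦ x ^ (m + 1) * u x ^ 2) volume 0 R :=
    ((hp _ (by linarith)).mul (hu.continuous.pow 2)).intervalIntegrable _ _
  have hquad (t : ℝ) :
      0 ≤ (∫ x in (0 : ℝ)..R, x ^ (m + 1) * u x ^ 2) * (t * t) +
        (2 * ∫ x in (0 : ℝ)..R, x ^ m * (u x * deriv u x)) * t +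
        ∫ x in (0 : ℝ)..R, x ^ (m - 1) * deriv u x ^ 2 := by
    have hnonneg : 0 ≤ ∫ x in (0 : ℝ)..R, ((t * t) * (x ^ (m + 1) * u x ^ 2) +
        (2 * t) * (x ^ m * (u x * deriv u x))) + x ^ (m - 1) * deriv u x ^ 2 := by
      refine intervalIntegral.integral_nonneg hR fun x hx ↦ ?_
      have e₁ : x ^ m = x ^ (m - 1) * x := by
        rw [← Real.rpow_add_one' hx.1 (by linarith), sub_add_cancel]
      have e₂ : x ^ (m + 1) = x ^ (m - 1) * x * x := by
        rw [Real.rpow_add_one' hx.1 (by linarith), e₁]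
      calc 0 ≤ x ^ (m - 1) * (deriv u x + t * x * u x) ^ 2 :=
            mul_nonneg (Real.rpow_nonneg hx.1 _) (sq_nonneg _)
        _ = _ := by rw [e₂, e₁]; ring
    rw [intervalIntegral.integral_add ((hC.const_mul _).add (hB.const_mul _)) hA,
      intervalIntegral.integral_add (hC.const_mul _) (hB.const_mul _),
      intervalIntegral.integral_const_mul, intervalIntegral.integral_const_mul] at hnonneg
    linarith
  have := discrim_le_zero hquad
  rw [discrim] at this
  linarith

theorem stmt_10 (N : ℝ) (hN : 1 < N) (k : ℕ) (u : ℝ → ℝ)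
    (hu : ∃ K : ℝ≥0, LipschitzWith K u)
    (hsupp : Bornology.IsBounded (Function.support u)) :
    (∫ x in Set.Ioi (0 : ℝ), x ^ (N + 2 * k - 1) * (deriv u x) ^ 2) *
      (∫ x in Set.Ioi (0 : ℝ), x ^ (N + 2 * k + 1) * (u x) ^ 2) ≥
    (N / 2 + k) ^ 2 * (∫ x in Set.Ioi (0 : ℝ), x ^ (N + 2 * k - 1) * (u x) ^ 2) ^ 2 := by
  obtain ⟨K, hu⟩ := hu
  obtain ⟨R, hR, hsub⟩ := hsupp.subset_closedBall_lt 0 0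
  have hzero : ∀ x, R < x → u x = 0 := fun x hx ↦ by
    by_contra h
    have := hsub h
    rw [Metric.mem_closedBall, dist_zero_right, Real.norm_eq_abs] at this
    linarith [le_abs_self x]
  have hderiv : ∀ x, R < x → deriv u x = 0 := fun x hx ↦ by
    have : u =ᶠ[nhds x] fun _ ↦ 0 := by
      filter_upwards [lt_mem_nhds hx] with y hy using hzero y hy
    rw [this.deriv_eq, deriv_const]
  have hRR : R < R + 1 := lt_add_one R
  have hset (f : ℝ → ℝ) (hf : ∀ x, R < x → f x = 0) :
      ∫ x in Set.Ioi (0 : ℝ), f x = ∫ x in (0 : ℝ)..(R + 1), f x := by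
    rw [intervalIntegral.integral_of_le (by linarith)]
    refine setIntegral_eq_of_subset_of_forall_sdiff_eq_zero measurableSet_Ioi
      Set.Ioc_subset_Ioi_self fun x hx ↦ hf x ?_
    by_contra h
    exact hx.2 ⟨hx.1, by linarith⟩
  have hm : 1 < N + 2 * k := by
    have : (0 : ℝ) ≤ k := k.cast_nonneg
    linarith
  rw [hset _ fun x hx ↦ by simp [hderiv x hx], hset _ fun x hx ↦ by simp [hzero x hx],
    hset _ fun x hx ↦ by simp [hzero x hx]]
  have hparts := hu.mul_integral_rpow_mul_sq hm (hzero _ hRR)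
  refine le_trans (le_of_eq ?_) (hu.sq_integral_rpow_mul_deriv_le hm (by linarith : 0 ≤ R + 1))
  rw [← mul_pow, ← neg_sq]
  congr 1
  linarith
end

section
/- Let N ≥ 1 be a positive integer, let k ≥ 0 and λ > 0 be real numbers, and let u : ℝ^N → ℝ be given by u(x) = exp(−λ|x|²), so that |∇u(x)| = 2λ|x| exp(−λ|x|²). Then equality holds in the L²-CKN inequality: (∫_{ℝ^N} |x|^{2k} |∇u(x)|² dx) · (∫_{ℝ^N} |x|^{2k+2} u(x)² dx) = (N/2 + k)² · (∫_{ℝ^N} |x|^{2k} u(x)² dx)². -/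
open MeasureTheory
open scoped ENNReal

lemma integral_norm_rpow_mul_exp_neg_mul_sq {N : ℕ} (hN : 1 ≤ N) {s b : ℝ} (hs : 0 ≤ s)
    (hb : 0 < b) :
    ∫ x : EuclideanSpace ℝ (Fin N), ‖x‖ ^ s * Real.exp (-b * ‖x‖ ^ 2) =
      N * (volume.real (Metric.ball (0 : EuclideanSpace ℝ (Fin N)) 1) *
        (b ^ (-(N + s) / 2) * (1 / 2) * Real.Gamma ((N + s) / 2))) := by
  have : NeZero N := ⟨by omega⟩
  have hN' : (1 : ℝ) ≤ N := by exact_mod_cast hN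
  have h := integral_rpow_mul_exp_neg_mul_rpow (p := 2) (q := N - 1 + s) two_pos (by linarith) hb
  rw [integral_fun_norm_addHaar volume fun r : ℝ => r ^ s * Real.exp (-b * r ^ 2),
    finrank_euclideanSpace_fin, nsmul_eq_mul, smul_eq_mul,
    show (N : ℝ) + s = N - 1 + s + 1 by ring, ← h]
  congr 2
  refine setIntegral_congr_fun measurableSet_Ioi fun r hr => ?_
  have hr : 0 < r := hr
  rw [smul_eq_mul, Real.rpow_add hr, ← Real.rpow_natCast, Nat.cast_sub hN, Nat.cast_one,
    Real.rpow_two, mul_assoc]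

lemma integral_norm_rpow_add_two_mul_exp_neg_mul_sq {N : ℕ} (hN : 1 ≤ N) {s b : ℝ} (hs : 0 ≤ s)
    (hb : 0 < b) :
    ∫ x : EuclideanSpace ℝ (Fin N), ‖x‖ ^ (s + 2) * Real.exp (-b * ‖x‖ ^ 2) =
      (N + s) / (2 * b) *
        ∫ x : EuclideanSpace ℝ (Fin N), ‖x‖ ^ s * Real.exp (-b * ‖x‖ ^ 2) := by
  have hpos : (0 : ℝ) < (N + s) / 2 := by
    have : (0 : ℝ) < N := by exact_mod_cast hN
    positivity
  rw [integral_norm_rpow_mul_exp_neg_mul_sq hN hs hb,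
    integral_norm_rpow_mul_exp_neg_mul_sq hN (by linarith) hb,
    show ((N : ℝ) + (s + 2)) / 2 = (N + s) / 2 + 1 by ring, Real.Gamma_add_one hpos.ne',
    show -((N : ℝ) + (s + 2)) / 2 = -(N + s) / 2 - 1 by ring, Real.rpow_sub_one hb.ne']
  field_simp

theorem stmt_11 (N : ℕ) (hN : 1 ≤ N) (k lam : ℝ) (hk : 0 ≤ k) (hlam : 0 < lam)
    (u : EuclideanSpace ℝ (Fin N) → ℝ) (hu : u = fun x => Real.exp (-lam * ‖x‖ ^ 2))
    (hgrad : ∀ x : EuclideanSpace ℝ (Fin N),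
      ‖gradient u x‖ = 2 * lam * ‖x‖ * Real.exp (-lam * ‖x‖ ^ 2)) :
    (∫ x : EuclideanSpace ℝ (Fin N), ‖x‖ ^ (2 * k) * ‖gradient u x‖ ^ 2) *
      (∫ x : EuclideanSpace ℝ (Fin N), ‖x‖ ^ (2 * k + 2) * (u x) ^ 2) =
    ((N : ℝ) / 2 + k) ^ 2 *
      (∫ x : EuclideanSpace ℝ (Fin N), ‖x‖ ^ (2 * k) * (u x) ^ 2) ^ 2 := by
  have hexp (r : ℝ) : Real.exp (-lam * r ^ 2) ^ 2 = Real.exp (-(2 * lam) * r ^ 2) := by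
    rw [← Real.exp_nat_mul]
    congr 1
    push_cast
    ring
  have hgrad_sq (x : EuclideanSpace ℝ (Fin N)) : ‖x‖ ^ (2 * k) * ‖gradient u x‖ ^ 2 =
      4 * lam ^ 2 * (‖x‖ ^ (2 * k + 2) * Real.exp (-(2 * lam) * ‖x‖ ^ 2)) := by
    rw [hgrad, mul_pow, hexp, Real.rpow_add_of_nonneg (norm_nonneg x) (by positivity) two_pos.le,
      Real.rpow_two]
    ring
  simp_rw [hgrad_sq, hu, hexp]
  rw [integral_const_mul, integral_norm_rpow_add_two_mul_exp_neg_mul_sq hN (by positivity)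
    (by positivity)]
  field_simp
  ring
end

section
/- Let N ≥ 1 be a positive integer and k ≥ 0 a real number. Then for every smooth compactly supported function u : ℝ^N → ℝ, (∫_{ℝ^N} |x|^{2k} |∇u(x)|² dx) · (∫_{ℝ^N} |x|^{2k+2} u(x)² dx) ≥ (N/2 + k)² · (∫_{ℝ^N} |x|^{2k} u(x)² dx)². -/
open MeasureTheory
open scoped ENNReal

theorem discrim_integral_le_zero {α : Type*} [MeasurableSpace α] {μ : Measure α} {a b c : α → ℝ}
    (ha : Integrable a μ) (hb : Integrable b μ) (hc : Integrable c μ)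
    (h : ∀ (t : ℝ) (x : α), 0 ≤ a x * (t * t) + b x * t + c x) :
    discrim (∫ x, a x ∂μ) (∫ x, b x ∂μ) (∫ x, c x ∂μ) ≤ 0 := by
  refine discrim_le_zero fun t ↦ ?_
  have hab : Integrable (fun x ↦ a x * (t * t) + b x * t) μ :=
    (ha.mul_const _).add (hb.mul_const _)
  rw [← integral_mul_const, ← integral_mul_const,
    ← integral_add (ha.mul_const _) (hb.mul_const _), ← integral_add hab hc]
  exact integral_nonneg (h t)

section Euler

variable {E : Type*} [NormedAddCommGroup E] [NormedSpace ℝ E] [FiniteDimensional ℝ E]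
  [MeasurableSpace E] [BorelSpace E]

/-- Differentiation at `s = 1` of the integral of the dilations of a compactly supported `C¹`
function against a continuous weight. -/
theorem hasDerivAt_integral_mul_comp_smul (μ : Measure E) [IsFiniteMeasureOnCompacts μ]
    {w v : E → ℝ} (hw : Continuous w) (hv : ContDiff ℝ 1 v) (hsupp : HasCompactSupport v) :
    HasDerivAt (fun s : ℝ ↦ ∫ x, w x * v (s • x) ∂μ) (∫ x, w x * fderiv ℝ v x x ∂μ) 1 := by
  obtain ⟨R, hR⟩ := hsupp.isCompact.isBounded.subset_closedBall (0 : E)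
  have hdv : Continuous (fderiv ℝ v) := hv.continuous_fderiv one_ne_zero
  have hF' : Continuous fun p : ℝ × E ↦ w p.2 * fderiv ℝ v (p.1 • p.2) p.2 := by fun_prop
  obtain ⟨C, hC⟩ := ((isCompact_closedBall (1 : ℝ) (1 / 2)).prod
    (isCompact_closedBall (0 : E) (2 * R))).exists_bound_of_continuousOn hF'.continuousOn
  have hint : Integrable (fun x ↦ w x * v ((1 : ℝ) • x)) μ := by
    simp only [one_smul]
    exact (hw.mul hv.continuous).integrable_of_hasCompactSupport hsupp.mul_left
  have hbound : ∀ x : E, ∀ s ∈ Metric.ball (1 : ℝ) (1 / 2), ‖w x * fderiv ℝ v (s • x) x‖ ≤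
      (Metric.closedBall (0 : E) (2 * R)).indicator (fun _ ↦ C) x := by
    intro x s hs
    by_cases hx : x ∈ Metric.closedBall (0 : E) (2 * R)
    · rw [Set.indicator_of_mem hx]
      exact hC (s, x) ⟨Metric.ball_subset_closedBall hs, hx⟩
    · rw [Set.indicator_of_notMem hx]
      have hs' : 1 / 2 < s := by
        rw [Metric.mem_ball, Real.dist_eq, abs_lt] at hs
        linarith
      have hzero : fderiv ℝ v (s • x) = 0 := by
        by_contra h
        have hmem := hR (support_fderiv_subset ℝ (Function.mem_support.mpr h))
        rw [mem_closedBall_zero_iff, norm_smul, Real.norm_of_nonneg (by linarith)] at hmem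
        rw [mem_closedBall_zero_iff, not_le] at hx
        nlinarith [norm_nonneg x]
      simp [hzero]
  have key := (hasDerivAt_integral_of_dominated_loc_of_deriv_le (μ := μ)
    (F := fun (s : ℝ) x ↦ w x * v (s • x)) (F' := fun s x ↦ w x * fderiv ℝ v (s • x) x)
    (Metric.ball_mem_nhds (1 : ℝ) one_half_pos)
    (.of_forall fun s ↦ (hw.mul (hv.continuous.comp (by fun_prop))).aestronglyMeasurable)
    hint (by fun_prop) (.of_forall hbound)
    ((integrable_indicator_iff Metric.isClosed_closedBall.measurableSet).mpr
      (integrableOn_const (isCompact_closedBall (0 : E) (2 * R)).measure_ne_top))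
    (.of_forall fun x s _ ↦ by
      have h1 : HasDerivAt (fun s : ℝ ↦ s • x) x s := by
        simpa using (hasDerivAt_id s).smul_const x
      exact ((hv.differentiable one_ne_zero _).hasFDerivAt.comp_hasDerivAt s h1).const_mul _)).2
  simpa using key

/-- Integration by parts along the Euler vector field, against a power of the norm. -/
theorem integral_norm_rpow_mul_fderiv_self (μ : Measure E) [μ.IsAddHaarMeasure]
    {a : ℝ} (ha : 0 ≤ a) {v : E → ℝ} (hv : ContDiff ℝ 1 v) (hsupp : HasCompactSupport v) :
    ∫ x, ‖x‖ ^ a * fderiv ℝ v x x ∂μ =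
      -((Module.finrank ℝ E : ℝ) + a) * ∫ x, ‖x‖ ^ a * v x ∂μ := by
  have hderiv := hasDerivAt_integral_mul_comp_smul μ
    (continuous_norm.rpow_const fun _ ↦ Or.inr ha) hv hsupp
  have hscale : ∀ s : ℝ, 0 < s → ∫ x, ‖x‖ ^ a * v (s • x) ∂μ =
      s ^ (-((Module.finrank ℝ E : ℝ) + a)) * ∫ x, ‖x‖ ^ a * v x ∂μ := by
    intro s hs
    have h := Measure.integral_comp_smul μ (fun x ↦ ‖x‖ ^ a * v x) s
    simp only [norm_smul, Real.norm_of_nonneg hs.le, smul_eq_mul,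
      Real.mul_rpow hs.le (norm_nonneg _), mul_assoc, integral_const_mul] at h
    rw [abs_of_pos (by positivity)] at h
    have hsa : 0 < s ^ a := Real.rpow_pos_of_pos hs a
    rw [Real.rpow_neg hs.le, Real.rpow_add hs, Real.rpow_natCast, mul_inv, mul_right_comm, ← h]
    field_simp
  have hpow := (Real.hasDerivAt_rpow_const (x := 1) (p := -((Module.finrank ℝ E : ℝ) + a))
    (Or.inl one_ne_zero)).mul_const (∫ x, ‖x‖ ^ a * v x ∂μ)
  rw [Real.one_rpow, mul_one] at hpow
  refine hderiv.unique (hpow.congr_of_eventuallyEq ?_)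
  filter_upwards [lt_mem_nhds one_pos] with s hs using hscale s hs

end Euler

theorem stmt_12 (N : ℕ) (hN : 1 ≤ N) (k : ℝ) (hk : 0 ≤ k)
    (u : EuclideanSpace ℝ (Fin N) → ℝ) (hu : ContDiff ℝ (⊤ : ℕ∞) u)
    (hsupp : HasCompactSupport u) :
    (∫ x : EuclideanSpace ℝ (Fin N), ‖x‖ ^ (2 * k) * ‖fderiv ℝ u x‖ ^ 2) *
      (∫ x : EuclideanSpace ℝ (Fin N), ‖x‖ ^ (2 * k + 2) * (u x) ^ 2) ≥
    ((N : ℝ) / 2 + k) ^ 2 *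
      (∫ x : EuclideanSpace ℝ (Fin N), ‖x‖ ^ (2 * k) * (u x) ^ 2) ^ 2 := by
  have hu1 : ContDiff ℝ 1 u := hu.of_le (by exact_mod_cast le_top)
  have hdu : Continuous (fderiv ℝ u) := hu1.continuous_fderiv one_ne_zero
  have hsq : HasCompactSupport fun x ↦ u x ^ 2 :=
    hsupp.comp_left (g := fun y : ℝ ↦ y ^ 2) (by simp)
  have hfderiv : ∀ x, fderiv ℝ (fun y ↦ u y ^ 2) x x = 2 * (u x * fderiv ℝ u x x) := by
    intro x
    rw [((hu1.differentiable one_ne_zero x).hasFDerivAt.pow 2).fderiv]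
    simp [mul_assoc]
  have hparts := integral_norm_rpow_mul_fderiv_self volume (by positivity : 0 ≤ 2 * k)
    (hu1.pow 2) hsq
  simp only [hfderiv, finrank_euclideanSpace_fin] at hparts
  have hw : Continuous fun x : EuclideanSpace ℝ (Fin N) ↦ ‖x‖ ^ (2 * k) :=
    continuous_norm.rpow_const fun _ ↦ Or.inr (by positivity)
  have hw2 : Continuous fun x : EuclideanSpace ℝ (Fin N) ↦ ‖x‖ ^ (2 * k + 2) :=
    continuous_norm.rpow_const fun _ ↦ Or.inr (by positivity)
  have hP : Integrable fun x ↦ ‖x‖ ^ (2 * k) * ‖fderiv ℝ u x‖ ^ 2 := by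
    have hc : Continuous fun x ↦ ‖x‖ ^ (2 * k) * ‖fderiv ℝ u x‖ ^ 2 := by fun_prop
    refine hc.integrable_of_hasCompactSupport ((hsupp.fderiv (𝕜 := ℝ)).mono fun x hx ↦ ?_)
    contrapose! hx
    simp [Function.notMem_support.mp hx]
  have hQ : Integrable fun x ↦ ‖x‖ ^ (2 * k + 2) * u x ^ 2 :=
    (hw2.mul (hu1.continuous.pow 2)).integrable_of_hasCompactSupport hsq.mul_left
  have hB : Integrable fun x ↦ ‖x‖ ^ (2 * k) * (2 * (u x * fderiv ℝ u x x)) := by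
    have hc : Continuous fun x ↦ ‖x‖ ^ (2 * k) * (2 * (u x * fderiv ℝ u x x)) := by fun_prop
    refine hc.integrable_of_hasCompactSupport (hsupp.mono fun x hx ↦ ?_)
    contrapose! hx
    simp [Function.notMem_support.mp hx]
  have hpoint : ∀ (t : ℝ) (x : EuclideanSpace ℝ (Fin N)),
      0 ≤ ‖x‖ ^ (2 * k) * ‖fderiv ℝ u x‖ ^ 2 * (t * t) +
        ‖x‖ ^ (2 * k) * (2 * (u x * fderiv ℝ u x x)) * t + ‖x‖ ^ (2 * k + 2) * u x ^ 2 := by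
    intro t x
    have habs : |t * u x * fderiv ℝ u x x| ≤ |t| * |u x| * (‖fderiv ℝ u x‖ * ‖x‖) := by
      rw [abs_mul, abs_mul]
      gcongr
      exact (fderiv ℝ u x).le_opNorm x
    have hmain : 0 ≤ ‖fderiv ℝ u x‖ ^ 2 * t ^ 2 + 2 * (t * u x * fderiv ℝ u x x) +
        ‖x‖ ^ 2 * u x ^ 2 := by
      rw [← sq_abs t, ← sq_abs (u x)]
      nlinarith [sq_nonneg (‖fderiv ℝ u x‖ * |t| - ‖x‖ * |u x|), neg_le_of_abs_le habs]
    rw [Real.rpow_add_of_nonneg (norm_nonneg x) (by positivity) zero_le_two, Real.rpow_two]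
    calc 0 ≤ ‖x‖ ^ (2 * k) * _ := mul_nonneg (by positivity) hmain
      _ = _ := by ring
  have hdisc := discrim_integral_le_zero hP hB hQ hpoint
  rw [discrim, hparts] at hdisc
  linarith
end

section
/- Let (X,d,m) be a metric measure space, x0 ∈ X, N ∈ (1,∞) a real number, and k ≥ 1 an integer. Assume the function ρ ↦ m(B_ρ(x0))/ρ^N is non-increasing on (0,∞). Then for every ρ > 0, ∫_{B_ρ(x0)} d(x0,x)^{2k} dm(x) ≤ (N/(N+2k)) · ρ^{2k} · m(B_ρ(x0)). In particular, if moreover m(B_ρ(x0)) ≤ L ρ^N for all ρ > 0 and some L > 0, then ∫_{B_ρ(x0)} d(x0,x)^{2k} dm(x) ≤ (N L/(N+2k)) ρ^{N+2k} for all ρ > 0. -/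
open MeasureTheory Metric
open scoped ENNReal

/-- Integral of the layer-cake density `n t ^ (n - 1)` against the tail bound
`V (1 - (t / ρ) ^ N)`. -/
lemma integral_tail_bound (N V ρ : ℝ) (hN : 0 < N) (hρ : 0 < ρ) (n : ℕ) :
    IntervalIntegrable
        (fun t : ℝ => V * ((n + 1) * t ^ n - (n + 1) * ρ ^ (-N) * t ^ (N + n)))
        volume 0 ρ ∧
      ∫ t in (0 : ℝ)..ρ, V * ((n + 1) * t ^ n - (n + 1) * ρ ^ (-N) * t ^ (N + n)) =
        N / (N + (n + 1)) * ρ ^ (n + 1) * V := by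
  have hn : (0 : ℝ) ≤ n := n.cast_nonneg
  have h1 : IntervalIntegrable (fun t : ℝ => ((n : ℝ) + 1) * t ^ n) volume 0 ρ :=
    Continuous.intervalIntegrable (by fun_prop) _ _
  have h2 : IntervalIntegrable (fun t : ℝ => ((n : ℝ) + 1) * ρ ^ (-N) * t ^ (N + n))
      volume 0 ρ :=
    (intervalIntegral.intervalIntegrable_rpow' (by linarith)).const_mul _
  refine ⟨(h1.sub h2).const_mul V, ?_⟩
  rw [intervalIntegral.integral_const_mul, intervalIntegral.integral_sub h1 h2,
    intervalIntegral.integral_const_mul, intervalIntegral.integral_const_mul, integral_pow,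
    integral_rpow (Or.inl (by linarith))]
  have h3 : ρ ^ (N + n + 1) = ρ ^ N * ρ ^ (n + 1) := by
    rw [add_assoc, Real.rpow_add hρ, ← Real.rpow_natCast ρ (n + 1)]
    push_cast
    rfl
  have h4 : ρ ^ N ≠ 0 := (Real.rpow_pos_of_pos hρ N).ne'
  have h5 : (n : ℝ) + 1 ≠ 0 := by positivity
  have h6 : N + n + 1 ≠ 0 := by positivity
  rw [h3, Real.rpow_neg hρ.le, Real.zero_rpow h6, ← add_assoc N]
  field_simp
  ring

/-- Tail bound for the distance function under the Bishop–Gromov monotonicity. -/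
lemma measure_restrict_ball_le_dist {X : Type*} [MetricSpace X] [MeasurableSpace X]
    [BorelSpace X] (m : Measure X) (x0 : X) (hfin : ∀ r : ℝ, m (ball x0 r) ≠ ⊤) (N : ℝ)
    (hBG : ∀ r R : ℝ, 0 < r → r ≤ R →
      (m (ball x0 R)).toReal / R ^ N ≤ (m (ball x0 r)).toReal / r ^ N)
    {t ρ : ℝ} (ht : 0 < t) (htρ : t ≤ ρ) :
    (m.restrict (ball x0 ρ)) {x | t ≤ dist x0 x} ≤
      ENNReal.ofReal ((m (ball x0 ρ)).toReal * (1 - ρ ^ (-N) * t ^ N)) := by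
  have hρ : 0 < ρ := ht.trans_le htρ
  have hset : {x | t ≤ dist x0 x} ∩ ball x0 ρ = ball x0 ρ \ ball x0 t := by
    ext x
    simp [dist_comm x0, and_comm]
  rw [Measure.restrict_apply' measurableSet_ball, hset,
    measure_sdiff (ball_subset_ball htρ) measurableSet_ball.nullMeasurableSet (hfin t),
    ← ENNReal.ofReal_toReal (hfin ρ), ← ENNReal.ofReal_toReal (hfin t),
    ← ENNReal.ofReal_sub _ ENNReal.toReal_nonneg]
  apply ENNReal.ofReal_le_ofReal
  rw [ENNReal.toReal_ofReal ENNReal.toReal_nonneg, Real.rpow_neg hρ.le]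
  have h := hBG t ρ ht htρ
  rw [le_div_iff₀ (Real.rpow_pos_of_pos ht N)] at h
  have h' : (m (ball x0 ρ)).toReal / ρ ^ N * t ^ N =
      (m (ball x0 ρ)).toReal * ((ρ ^ N)⁻¹ * t ^ N) := by ring
  linarith

/-- Moment bound for the distance function under the Bishop–Gromov monotonicity. -/
lemma integral_dist_pow_ball_le {X : Type*} [MetricSpace X] [MeasurableSpace X]
    [BorelSpace X] (m : Measure X) (x0 : X) (hfin : ∀ r : ℝ, m (ball x0 r) ≠ ⊤) (N : ℝ)
    (hN : 0 < N)
    (hBG : ∀ r R : ℝ, 0 < r → r ≤ R →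
      (m (ball x0 R)).toReal / R ^ N ≤ (m (ball x0 r)).toReal / r ^ N)
    (n : ℕ) {ρ : ℝ} (hρ : 0 < ρ) :
    ∫ x in ball x0 ρ, dist x0 x ^ (n + 1) ∂m ≤
      N / (N + (n + 1)) * ρ ^ (n + 1) * (m (ball x0 ρ)).toReal := by
  set V := (m (ball x0 ρ)).toReal with hV
  have hV0 : 0 ≤ V := ENNReal.toReal_nonneg
  obtain ⟨hint, hval⟩ := integral_tail_bound N V ρ hN hρ n
  have hmeas : Measurable fun x : X => dist x0 x :=
    (continuous_const.dist continuous_id).measurable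
  have hpos : ∀ t ∈ Set.Ioc (0 : ℝ) ρ,
      V * (1 - ρ ^ (-N) * t ^ N) * ((n + 1) * t ^ n) =
        V * ((n + 1) * t ^ n - (n + 1) * ρ ^ (-N) * t ^ (N + n)) := by
    intro t ht
    rw [Real.rpow_add ht.1, Real.rpow_natCast]
    ring
  have hfac : ∀ t ∈ Set.Ioc (0 : ℝ) ρ, 0 ≤ V * (1 - ρ ^ (-N) * t ^ N) := by
    intro t ht
    refine mul_nonneg hV0 (sub_nonneg.2 ?_)
    rw [Real.rpow_neg hρ.le, inv_mul_le_iff₀ (Real.rpow_pos_of_pos hρ N), mul_one]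
    exact Real.rpow_le_rpow ht.1.le ht.2 hN.le
  have hcake := lintegral_comp_eq_lintegral_meas_le_mul (m.restrict (ball x0 ρ))
    (f := fun x => dist x0 x) (g := fun t : ℝ => ((n : ℝ) + 1) * t ^ n)
    (Filter.Eventually.of_forall fun _ => dist_nonneg) hmeas.aemeasurable
    (fun t _ => Continuous.intervalIntegrable (by fun_prop) _ _)
    (by
      filter_upwards [ae_restrict_mem measurableSet_Ioi] with t ht
      have ht' : (0 : ℝ) < t := ht
      positivity)
  have hG : ∀ s : ℝ, ∫ t in (0 : ℝ)..s, ((n : ℝ) + 1) * t ^ n = s ^ (n + 1) := by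
    intro s
    rw [intervalIntegral.integral_const_mul, integral_pow]
    have : (n : ℝ) + 1 ≠ 0 := by positivity
    field_simp
    simp
  simp only [hG] at hcake
  rw [integral_eq_lintegral_of_nonneg_ae (Filter.Eventually.of_forall fun _ => by positivity)
    (hmeas.pow_const _).aestronglyMeasurable, hcake]
  refine ENNReal.toReal_le_of_le_ofReal (by positivity) ?_
  rw [← hval, intervalIntegral.integral_of_le hρ.le,
    ofReal_integral_eq_lintegral_ofReal hint.1
      (by
        filter_upwards [ae_restrict_mem measurableSet_Ioc] with t ht
        have := ht.1
        rw [← hpos t ht]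
        exact mul_nonneg (hfac t ht) (by positivity)),
    ← Set.Ioc_union_Ioi_eq_Ioi hρ.le]
  refine (lintegral_union_le _ _ _).trans ?_
  have hzero : ∫⁻ t in Set.Ioi ρ, (m.restrict (ball x0 ρ)) {x | t ≤ dist x0 x} *
      ENNReal.ofReal (((n : ℝ) + 1) * t ^ n) = 0 := by
    refine (setLIntegral_congr_fun measurableSet_Ioi fun t ht => ?_).trans lintegral_zero
    have hset : {x | t ≤ dist x0 x} ∩ ball x0 ρ = ∅ := by
      ext x
      have ht' : ρ < t := ht
      simp only [Set.mem_inter_iff, Set.mem_ofPred_eq, mem_ball', Set.mem_empty_iff_false,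
        iff_false, not_and, not_lt]
      exact fun h => ht'.le.trans h
    simp [Measure.restrict_apply' measurableSet_ball, hset]
  rw [hzero, add_zero]
  refine setLIntegral_mono' measurableSet_Ioc fun t ht => ?_
  rw [← hpos t ht, ENNReal.ofReal_mul (hfac t ht)]
  gcongr
  exact measure_restrict_ball_le_dist m x0 hfin N hBG ht.1 ht.2

theorem stmt_14 {X : Type*} [MetricSpace X] [CompleteSpace X]
    [TopologicalSpace.SeparableSpace X] [MeasurableSpace X] [BorelSpace X]
    (m : Measure X)
    (hm : ∀ U : Set X, IsOpen U → U.Nonempty → Bornology.IsBounded U → 0 < m U ∧ m U < ⊤)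
    (x0 : X) (N : ℝ) (hN : 1 < N) (k : ℕ) (hk : 1 ≤ k)
    (hBG : ∀ r R : ℝ, 0 < r → r ≤ R →
      (m (ball x0 R)).toReal / R ^ N ≤ (m (ball x0 r)).toReal / r ^ N) :
    (∀ ρ : ℝ, 0 < ρ →
      (∫ x in ball x0 ρ, dist x0 x ^ (2 * k) ∂m) ≤
        N / (N + 2 * k) * ρ ^ (2 * k) * (m (ball x0 ρ)).toReal) ∧
    (∀ L : ℝ, 0 < L → (∀ ρ : ℝ, 0 < ρ → (m (ball x0 ρ)).toReal ≤ L * ρ ^ N) →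
      ∀ ρ : ℝ, 0 < ρ →
        (∫ x in ball x0 ρ, dist x0 x ^ (2 * k) ∂m) ≤
          N * L / (N + 2 * k) * ρ ^ (N + 2 * k)) := by
  have hfin : ∀ r : ℝ, m (ball x0 r) ≠ ⊤ := by
    intro r
    rcases (ball x0 r).eq_empty_or_nonempty with h | h
    · simp [h]
    · exact (hm _ isOpen_ball h isBounded_ball).2.ne
  have key : ∀ ρ : ℝ, 0 < ρ →
      (∫ x in ball x0 ρ, dist x0 x ^ (2 * k) ∂m) ≤
        N / (N + 2 * k) * ρ ^ (2 * k) * (m (ball x0 ρ)).toReal := by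
    intro ρ hρ
    have h := integral_dist_pow_ball_le m x0 hfin N (by linarith) hBG (2 * k - 1) hρ
    have hk' : 2 * k - 1 + 1 = 2 * k := by omega
    have hc : ((2 * k - 1 : ℕ) : ℝ) + 1 = 2 * k := by exact_mod_cast hk'
    rwa [hk', hc] at h
  refine ⟨key, fun L _ hL ρ hρ => (key ρ hρ).trans ?_⟩
  have hpow : ρ ^ (N + 2 * k) = ρ ^ N * ρ ^ (2 * k) := by
    rw [Real.rpow_add hρ, ← Real.rpow_natCast ρ (2 * k)]
    push_cast
    rfl
  have hc : 0 ≤ N / (N + 2 * k) * ρ ^ (2 * k) := by positivity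
  calc N / (N + 2 * k) * ρ ^ (2 * k) * (m (ball x0 ρ)).toReal
      ≤ N / (N + 2 * k) * ρ ^ (2 * k) * (L * ρ ^ N) :=
        mul_le_mul_of_nonneg_left (hL ρ hρ) hc
    _ = N * L / (N + 2 * k) * ρ ^ (N + 2 * k) := by
        rw [hpow]
        ring
end

section
/- Let (X,d,m) be a metric measure space, x0 ∈ X, N ∈ (1,∞) a real number, and k ≥ 1 an integer. Assume the function ρ ↦ m(B_ρ(x0))/ρ^N is non-increasing on (0,∞) and that lim_{ρ→0⁺} m(B_ρ(x0))/ρ^N = L for some L ∈ (0,∞). Then lim_{ρ→0⁺} (∫_{B_ρ(x0)} d(x0,x)^{2k} dm(x)) / ρ^{N+2k} = N L/(N+2k). -/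
open MeasureTheory Metric Filter
open scoped ENNReal Topology

/-- Averaging an asymptotic `G u ~ L u ^ q` at `0⁺`. -/
theorem tendsto_integral_div_rpow_of_tendsto_div_rpow {G : ℝ → ℝ} {q L : ℝ} (hq : 0 < q)
    (hG : ∀ a, 0 ≤ a → IntervalIntegrable G volume 0 a)
    (hlim : Tendsto (fun u => G u / u ^ q) (𝓝[>] 0) (𝓝 L)) :
    Tendsto (fun a => (∫ u in (0 : ℝ)..a, G u) / a ^ (q + 1)) (𝓝[>] 0) (𝓝 (L / (q + 1))) := by
  rw [Metric.tendsto_nhds] at hlim ⊢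
  intro ε hε
  obtain ⟨δ, hδ, hclose⟩ := mem_nhdsGT_iff_exists_Ioc_subset.1 (hlim ε hε)
  filter_upwards [Ioc_mem_nhdsGT hδ, self_mem_nhdsWithin] with a ha ha0
  rw [Set.mem_Ioi] at ha0
  have hpow (c : ℝ) : IntervalIntegrable (fun u : ℝ => c * u ^ q) volume 0 a :=
    (intervalIntegral.intervalIntegrable_rpow' (by linarith)).const_mul c
  have hint (c : ℝ) : ∫ u in (0 : ℝ)..a, c * u ^ q = c * (a ^ (q + 1) / (q + 1)) := by
    rw [intervalIntegral.integral_const_mul, integral_rpow (Or.inl (by linarith)),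
      Real.zero_rpow (by linarith), sub_zero]
  have hbound : ‖∫ u in (0 : ℝ)..a, (G u - L * u ^ q)‖ ≤ ∫ u in (0 : ℝ)..a, ε * u ^ q := by
    refine intervalIntegral.norm_integral_le_of_norm_le ha0.le ?_ (hpow ε)
    refine Eventually.of_forall fun u hu => ?_
    have huq : 0 < u ^ q := Real.rpow_pos_of_pos hu.1 q
    have h : dist (G u / u ^ q) L < ε := hclose ⟨hu.1, hu.2.trans ha.2⟩
    have hfactor : G u - L * u ^ q = (G u / u ^ q - L) * u ^ q := by field_simp
    rw [hfactor, norm_mul, Real.norm_of_nonneg huq.le, ← dist_eq_norm]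
    gcongr
  rw [intervalIntegral.integral_sub (hG a ha0.le) (hpow L), hint, hint] at hbound
  have hapow : 0 < a ^ (q + 1) := Real.rpow_pos_of_pos ha0 _
  have hq1 : 0 < q + 1 := by linarith
  have hfactor : (∫ u in (0 : ℝ)..a, G u) / a ^ (q + 1) - L / (q + 1) =
      ((∫ u in (0 : ℝ)..a, G u) - L * (a ^ (q + 1) / (q + 1))) / a ^ (q + 1) := by
    field_simp
  rw [dist_eq_norm, hfactor, norm_div, Real.norm_of_nonneg hapow.le, div_lt_iff₀ hapow]
  refine hbound.trans_lt ?_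
  gcongr
  exact div_lt_self hapow (by linarith)

/-- The layer cake formula for `ρ ^ p - dist x0 x ^ p` on a ball. -/
theorem setIntegral_ball_dist_pow {X : Type*} [MetricSpace X] [MeasurableSpace X] [BorelSpace X]
    (m : Measure X) (x0 : X) {ρ : ℝ} (hρ : 0 < ρ) (hfin : m (ball x0 ρ) ≠ ⊤)
    {p : ℕ} (hp : p ≠ 0) :
    ∫ x in ball x0 ρ, dist x0 x ^ p ∂m =
      ρ ^ p * m.real (ball x0 ρ) -
        ∫ u in (0 : ℝ)..ρ ^ p, m.real (ball x0 (u ^ (p⁻¹ : ℝ))) := by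
  have : IsFiniteMeasure (m.restrict (ball x0 ρ)) := ⟨by simpa using hfin.lt_top⟩
  have hle : ∀ x ∈ ball x0 ρ, dist x0 x ^ p ≤ ρ ^ p := fun x hx =>
    pow_le_pow_left₀ dist_nonneg (mem_ball'.1 hx).le p
  have hmeas : Continuous fun x : X => dist x0 x ^ p := by fun_prop
  have hint : IntegrableOn (fun x => dist x0 x ^ p) (ball x0 ρ) m := by
    refine Integrable.of_bound hmeas.measurable.aestronglyMeasurable (ρ ^ p) ?_
    refine (ae_restrict_iff' measurableSet_ball).2 (Eventually.of_forall fun x hx => ?_)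
    rw [Real.norm_of_nonneg (by positivity)]
    exact hle x hx
  have hcake : ∫ x in ball x0 ρ, (ρ ^ p - dist x0 x ^ p) ∂m =
      ∫ u in (0 : ℝ)..ρ ^ p, m.real (ball x0 (u ^ (p⁻¹ : ℝ))) := by
    have hdiff : IntegrableOn (fun x => ρ ^ p - dist x0 x ^ p) (ball x0 ρ) m :=
      (integrable_const (ρ ^ p)).sub hint
    rw [Integrable.integral_eq_integral_meas_lt hdiff
      ((ae_restrict_iff' measurableSet_ball).2 (Eventually.of_forall fun x hx =>
        sub_nonneg.2 (hle x hx)))]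
    have hlevel : ∀ t ∈ Set.Ioi (0 : ℝ),
        (m.restrict (ball x0 ρ)).real {x | t < ρ ^ p - dist x0 x ^ p} =
          (Set.Ioc 0 (ρ ^ p)).indicator
            (fun t => m.real (ball x0 ((ρ ^ p - t) ^ (p⁻¹ : ℝ)))) t := by
      intro t ht
      rw [Set.mem_Ioi] at ht
      rw [measureReal_restrict_apply
        (isOpen_lt continuous_const (by fun_prop)).measurableSet]
      by_cases htρ : t ≤ ρ ^ p
      · rw [Set.indicator_of_mem (Set.mem_Ioc.2 ⟨ht, htρ⟩)]
        congr 1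
        ext x
        have hs : 0 ≤ ρ ^ p - t := sub_nonneg.2 htρ
        have hiff : dist x0 x < (ρ ^ p - t) ^ (p⁻¹ : ℝ) ↔ dist x0 x ^ p < ρ ^ p - t := by
          conv_rhs => rw [← Real.rpow_inv_natCast_pow hs hp]
          exact (pow_lt_pow_iff_left₀ dist_nonneg (by positivity) hp).symm
        simp only [Set.mem_inter_iff, Set.mem_ofPred_eq, mem_ball', hiff]
        refine ⟨fun h => by linarith [h.1], fun h => ⟨by linarith, ?_⟩⟩
        exact lt_of_pow_lt_pow_left₀ p hρ.le (by linarith)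
      · rw [Set.indicator_of_notMem fun h => htρ h.2]
        convert measureReal_empty
        ext x
        simp only [Set.mem_inter_iff, Set.mem_ofPred_eq, Set.mem_empty_iff_false, iff_false]
        intro h
        have : 0 ≤ dist x0 x ^ p := by positivity
        linarith [h.1]
    rw [setIntegral_congr_fun measurableSet_Ioi hlevel, setIntegral_indicator measurableSet_Ioc,
      Set.inter_eq_right.2 Set.Ioc_subset_Ioi_self,
      ← intervalIntegral.integral_of_le (by positivity),
      intervalIntegral.integral_comp_sub_left (fun u => m.real (ball x0 (u ^ (p⁻¹ : ℝ)))),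
      sub_self, sub_zero]
  rw [← hcake, integral_sub (integrable_const _) hint, setIntegral_const, smul_eq_mul]
  ring

theorem stmt_15 {X : Type*} [MetricSpace X] [CompleteSpace X]
    [TopologicalSpace.SeparableSpace X] [MeasurableSpace X] [BorelSpace X]
    (m : Measure X)
    (hm : ∀ U : Set X, IsOpen U → U.Nonempty → Bornology.IsBounded U → 0 < m U ∧ m U < ⊤)
    (x0 : X) (N : ℝ) (hN : 1 < N) (k : ℕ) (hk : 1 ≤ k)
    (hBG : ∀ r R : ℝ, 0 < r → r ≤ R →
      (m (ball x0 R)).toReal / R ^ N ≤ (m (ball x0 r)).toReal / r ^ N)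
    (L : ℝ) (hL : 0 < L)
    (hlim : Tendsto (fun ρ : ℝ => (m (ball x0 ρ)).toReal / ρ ^ N) (𝓝[>] 0) (𝓝 L)) :
    Tendsto (fun ρ : ℝ =>
        (∫ x in ball x0 ρ, dist x0 x ^ (2 * k) ∂m) / ρ ^ (N + 2 * k))
      (𝓝[>] 0) (𝓝 (N * L / (N + 2 * k))) := by
  have hfin (r : ℝ) : m (ball x0 r) ≠ ⊤ := by
    rcases (ball x0 r).eq_empty_or_nonempty with h | h
    · simp [h]
    · exact (hm _ isOpen_ball h isBounded_ball).2.ne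
  obtain ⟨p, hp⟩ : ∃ p, p = 2 * k := ⟨_, rfl⟩
  have hp0 : p ≠ 0 := by omega
  have hpR : 0 < (p : ℝ) := by positivity
  have hcast : (2 * k : ℝ) = p := by rw [hp]; push_cast; rfl
  rw [hcast, ← hp]
  have hmono : MonotoneOn (fun u : ℝ => m.real (ball x0 (u ^ (p⁻¹ : ℝ)))) (Set.Ici 0) :=
    fun u hu v _ huv => measureReal_mono
      (ball_subset_ball (Real.rpow_le_rpow hu huv (by positivity))) (hfin _)
  have hroot : Tendsto (fun u : ℝ => u ^ (p⁻¹ : ℝ)) (𝓝[>] 0) (𝓝[>] 0) := by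
    refine tendsto_nhdsWithin_iff.2 ⟨?_, ?_⟩
    · have h := (Real.continuous_rpow_const (q := (p⁻¹ : ℝ)) (by positivity)).tendsto 0
      rw [Real.zero_rpow (by positivity)] at h
      exact h.mono_left nhdsWithin_le_nhds
    · filter_upwards [self_mem_nhdsWithin] with u hu
      exact Real.rpow_pos_of_pos hu _
  have hpow : Tendsto (fun r : ℝ => r ^ p) (𝓝[>] 0) (𝓝[>] 0) := by
    refine tendsto_nhdsWithin_iff.2 ⟨?_, ?_⟩
    · have h := (continuous_pow p).tendsto (0 : ℝ)
      rw [zero_pow hp0] at h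
      exact h.mono_left nhdsWithin_le_nhds
    · filter_upwards [self_mem_nhdsWithin] with r hr
      exact pow_pos (Set.mem_Ioi.1 hr) _
  have hdensity : Tendsto (fun u : ℝ => m.real (ball x0 (u ^ (p⁻¹ : ℝ))) / u ^ (N / p))
      (𝓝[>] 0) (𝓝 L) := by
    refine (hlim.comp hroot).congr' ?_
    filter_upwards [self_mem_nhdsWithin] with u hu
    rw [Function.comp_apply, ← Real.rpow_mul (le_of_lt hu), inv_mul_eq_div]
    rfl
  have haverage := (tendsto_integral_div_rpow_of_tendsto_div_rpow (by positivity)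
    (fun a ha => (hmono.mono (by rw [Set.uIcc_of_le ha]; exact Set.Icc_subset_Ici_self)
      ).intervalIntegrable) hdensity).comp hpow
  have hvalue : L - L / (N / p + 1) = N * L / (N + p) := by
    field_simp
    ring
  rw [← hvalue]
  refine (hlim.sub haverage).congr' ?_
  filter_upwards [self_mem_nhdsWithin] with r hr
  rw [Set.mem_Ioi] at hr
  have hexp : (r ^ p) ^ (N / p + 1) = r ^ N * r ^ p := by
    rw [← Real.rpow_natCast, ← Real.rpow_mul hr.le, ← Real.rpow_add hr]
    congr 1
    field_simp
  rw [Function.comp_apply, setIntegral_ball_dist_pow m x0 hr (hfin r) hp0, hexp,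
    Real.rpow_add hr, Real.rpow_natCast, sub_div, Measure.real,
    mul_comm (r ^ p) (m (ball x0 r)).toReal, mul_div_mul_right _ _ (pow_pos hr p).ne']
end
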